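/- arXiv:1203.5175 — 2 statements merged into one kernel-verified Lean document; each statement's English description precedes it below -/
import Mathlib

section
/- P_G is strongly flag-connected: for any two flags Φ and Ψ of P_G there exists a finite sequence of flags Φ = Φ_0, Φ_1, …, Φ_l = Ψ such that for each i the flags Φ_{i-1} and Φ_i differ in exactly one face, and every flag Φ_i in the sequence contains Φ ∩ Ψ. -/
open SimpleGraph

variable {V R : Type*}

/-- The spanning subgraph of `G` keeping only the edges whose color lies in `C`. -/
def colorSub (G : SimpleGraph V) (c : V → V → R) (C : Finset R) : SimpleGraph V :=
  SimpleGraph.fromRel (fun a b => G.Adj a b ∧ c a b ∈ C)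

/-- `v` and `w` are `C`-equivalent: joined by a walk all of whose edges have colors in `C`. -/
def cEquiv (G : SimpleGraph V) (c : V → V → R) (C : Finset R) (v w : V) : Prop :=
  (colorSub G c C).Reachable v w

/-- `c` is a proper edge coloring of `G` such that at each vertex the colors of the incident
edges are pairwise distinct and exhaust the color set `R`
(so `G` is a properly edge-colored `|R|`-regular graph). -/
structure IsProperColoring (G : SimpleGraph V) (c : V → V → R) : Prop where
  symm : ∀ v w, G.Adj v w → c v w = c w v
  bijOn : ∀ v : V, Set.BijOn (fun w => c v w) (G.neighborSet v) Set.univ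

/-- The preorder on pairs `(C, v)`. -/
def faceLE (G : SimpleGraph V) (c : V → V → R) (p q : Finset R × V) : Prop :=
  p.1 ⊆ q.1 ∧ cEquiv G c q.1 p.2 q.2

/-- The identification `(C,v) = (D,w)` iff `C = D` and `v ∼_C w`. -/
def faceSetoid (G : SimpleGraph V) (c : V → V → R) : Setoid (Finset R × V) where
  r p q := p.1 = q.1 ∧ cEquiv G c p.1 p.2 q.2
  iseqv := by
    constructor
    · exact fun p => ⟨rfl, SimpleGraph.Reachable.refl _⟩
    · rintro p q ⟨h1, h2⟩
      refine ⟨h1.symm, ?_⟩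
      rw [← h1]
      exact h2.symm
    · rintro p q u ⟨h1, h2⟩ ⟨h3, h4⟩
      refine ⟨h1.trans h3, h2.trans ?_⟩
      rw [h1]
      exact h4

lemma colorSub_mono (G : SimpleGraph V) (c : V → V → R) {C D : Finset R} (h : C ⊆ D) :
    colorSub G c C ≤ colorSub G c D := by
  intro a b hab
  obtain ⟨hne, h'⟩ := hab
  exact ⟨hne, h'.imp (fun hx => ⟨hx.1, h hx.2⟩) (fun hx => ⟨hx.1, h hx.2⟩)⟩

lemma cEquiv_mono (G : SimpleGraph V) (c : V → V → R) {C D : Finset R} (h : C ⊆ D)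
    {v w : V} (hvw : cEquiv G c C v w) : cEquiv G c D v w :=
  hvw.mono (colorSub_mono G c h)

/-- The faces of the colorful polytope `P_G`. -/
def ColorfulFace (G : SimpleGraph V) (c : V → V → R) : Type _ :=
  Quotient (faceSetoid G c)

/-- The face of `P_G` represented by the pair `(C, v)`. -/
def mkFace (G : SimpleGraph V) (c : V → V → R) (C : Finset R) (v : V) : ColorfulFace G c :=
  Quotient.mk (faceSetoid G c) (C, v)

/-- The partial order of the colorful polytope `P_G`. -/
instance ColorfulFace.instPartialOrder (G : SimpleGraph V) (c : V → V → R) :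
    PartialOrder (ColorfulFace G c) where
  le := Quotient.lift₂ (faceLE G c) (by
    rintro p q p' q' ⟨hp1, hp2⟩ ⟨hq1, hq2⟩
    ext
    constructor
    · rintro ⟨hsub, hreach⟩
      constructor
      · rw [← hp1, ← hq1]; exact hsub
      · rw [← hq1]
        have h1 : cEquiv G c q.1 p'.2 p.2 := cEquiv_mono G c hsub (hp1 ▸ hp2.symm)
        exact (h1.trans hreach).trans hq2
    · rintro ⟨hsub, hreach⟩
      constructor
      · rw [hp1, hq1]; exact hsub
      · rw [hq1]
        have h2 : cEquiv G c q'.1 p.2 p'.2 := by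
          refine cEquiv_mono G c ?_ hp2
          rw [hp1]; exact hsub
        refine (h2.trans hreach).trans ?_
        rw [hq1] at hq2
        exact hq2.symm)
  le_refl := by
    refine Quotient.ind (fun p => ?_)
    exact ⟨subset_rfl, SimpleGraph.Reachable.refl _⟩
  le_trans := by
    refine Quotient.ind fun p => Quotient.ind fun q => Quotient.ind fun u => ?_
    rintro ⟨h1, h2⟩ ⟨h3, h4⟩
    exact ⟨h1.trans h3, (cEquiv_mono G c h3 h2).trans h4⟩
  le_antisymm := by
    refine Quotient.ind fun p => Quotient.ind fun q => ?_
    rintro ⟨h1, h2⟩ ⟨h3, h4⟩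
    exact Quotient.sound ⟨subset_antisymm h1 h3, subset_antisymm h3 h1 ▸ h2⟩

/-- The rank of a face of `P_G`. -/
def faceRank (G : SimpleGraph V) (c : V → V → R) : ColorfulFace G c → ℕ :=
  Quotient.lift (fun p => p.1.card) (fun p q h => by
    show p.1.card = q.1.card
    rw [(h.1 : p.1 = q.1)])

open Relation

section Faces

variable {G : SimpleGraph V} {c : V → V → R}

lemma mkFace_eq_iff {C D : Finset R} {v w : V} :
    mkFace G c C v = mkFace G c D w ↔ C = D ∧ cEquiv G c C v w :=
  Quotient.eq (r := faceSetoid G c)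

lemma mkFace_le_iff {C D : Finset R} {v w : V} :
    mkFace G c C v ≤ mkFace G c D w ↔ C ⊆ D ∧ cEquiv G c D v w :=
  Iff.rfl

lemma exists_eq_mkFace (x : ColorfulFace G c) : ∃ C v, x = mkFace G c C v :=
  Quotient.ind (motive := fun x => ∃ C v, x = mkFace G c C v) (fun p => ⟨p.1, p.2, rfl⟩) x

lemma faceRank_mkFace (C : Finset R) (v : V) : faceRank G c (mkFace G c C v) = C.card := rfl

lemma eq_of_le_of_faceRank_le {x y : ColorfulFace G c} (h : x ≤ y)
    (hr : faceRank G c y ≤ faceRank G c x) : x = y := by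
  obtain ⟨C, v, rfl⟩ := exists_eq_mkFace x
  obtain ⟨D, w, rfl⟩ := exists_eq_mkFace y
  obtain ⟨hCD, hvw⟩ := mkFace_le_iff.1 h
  obtain rfl := Finset.eq_of_subset_of_card_le hCD hr
  exact mkFace_eq_iff.2 ⟨rfl, hvw⟩

lemma cEquiv_empty_iff {v w : V} : cEquiv G c ∅ v w ↔ v = w := by
  have : colorSub G c (∅ : Finset R) = ⊥ := by
    ext a b
    simp [colorSub]
  rw [cEquiv, this, SimpleGraph.reachable_bot]

lemma cEquiv_univ [Fintype R] (hconn : G.Connected) (v w : V) :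
    cEquiv G c Finset.univ v w := by
  refine (hconn.preconnected v w).mono fun a b hab => ?_
  exact ⟨hab.ne, Or.inl ⟨hab, Finset.mem_univ _⟩⟩

lemma exists_color_of_adj {C : Finset R} {u v : V} (h : (colorSub G c C).Adj u v) :
    ∃ a ∈ C, (colorSub G c {a}).Adj u v := by
  obtain ⟨hne, h | h⟩ := h
  · exact ⟨c u v, h.2, hne, Or.inl ⟨h.1, Finset.mem_singleton_self _⟩⟩
  · exact ⟨c v u, h.2, hne, Or.inr ⟨h.1, Finset.mem_singleton_self _⟩⟩

end Faces

lemma exists_adjacent_inversion {n : ℕ} {f g : R ≃ Fin n} (hfg : f ≠ g) :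
    ∃ i j : Fin n, (j : ℕ) = i + 1 ∧ g (f.symm j) < g (f.symm i) := by
  by_contra! hno
  apply hfg
  have hmono : StrictMono (f.symm.trans g) := by
    rcases n with _ | n
    · exact fun i => i.elim0
    · refine Fin.strictMono_iff_lt_succ.2 fun i => ?_
      refine lt_of_le_of_ne (hno i.castSucc i.succ (by simp)) fun h => ?_
      exact (Fin.castSucc_lt_succ (i := i)).ne ((f.symm.trans g).injective h)
  have hid := Subsingleton.elim
    (hmono.orderIsoOfSurjective _ (f.symm.trans g).surjective) (OrderIso.refl _)
  ext a
  have := DFunLike.congr_fun hid (f a)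
  simp at this
  rw [this]

section InitialSegments

variable [Fintype R] {n : ℕ}

/-- The set of colors at positions less than `k` in the ordering `f` of the colors. -/
def initSeg (f : R ≃ Fin n) (k : Fin (n + 1)) : Finset R :=
  Finset.univ.filter fun a => (f a : ℕ) < k

@[simp]
lemma mem_initSeg {f : R ≃ Fin n} {k : Fin (n + 1)} {a : R} :
    a ∈ initSeg f k ↔ (f a : ℕ) < k := by
  simp [initSeg]

lemma initSeg_mono (f : R ≃ Fin n) : Monotone (initSeg f) := fun k l hkl a ha => by
  rw [mem_initSeg] at ha ⊢
  exact ha.trans_le hkl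

lemma card_initSeg (f : R ≃ Fin n) (k : Fin (n + 1)) : (initSeg f k).card = k := by
  have h : (initSeg f k).map f.toEmbedding = Finset.univ.filter fun i : Fin n => (i : ℕ) < k := by
    ext i
    simp [Finset.mem_map_equiv]
  rw [← Finset.card_map f.toEmbedding, h, Fin.card_filter_val_lt]
  omega

/-- A set of colors preceding all other colors in the ordering `f` is an initial segment. -/
lemma exists_eq_initSeg (f : R ≃ Fin n) (D : Finset R)
    (hD : ∀ a ∈ D, ∀ b ∉ D, f a < f b) : ∃ k, D = initSeg f k := by
  have hcard : D.card < n + 1 := by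
    have := Finset.card_le_univ D
    rw [Fintype.card_congr f, Fintype.card_fin] at this
    omega
  refine ⟨⟨D.card, hcard⟩, ?_⟩
  have hk := card_initSeg f ⟨D.card, hcard⟩
  by_cases hsub : D ⊆ initSeg f ⟨D.card, hcard⟩
  · exact Finset.eq_of_subset_of_card_le hsub hk.le
  · obtain ⟨a, haD, ha⟩ := Finset.not_subset.1 hsub
    refine (Finset.eq_of_subset_of_card_le (fun b hb => ?_) hk.ge).symm
    by_contra hbD
    have := hD a haD b hbD
    simp only [mem_initSeg] at ha hb
    omega

/-- Some ordering of the colors refines a given weight function. -/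
lemma exists_equiv_lt_of_lt (hn : Fintype.card R = n) (φ : R → ℕ) :
    ∃ f : R ≃ Fin n, ∀ a b, φ a < φ b → f a < f b := by
  let e : R ≃ Fin n := Fintype.equivFinOfCardEq hn
  have hmono := Tuple.monotone_sort (φ ∘ e.symm)
  refine ⟨e.trans (Tuple.sort (φ ∘ e.symm)).symm, fun a b hab => ?_⟩
  by_contra! hle
  have := hmono hle
  simp at this
  omega

/-- Every chain of color sets consists of initial segments of some ordering of the colors. -/
lemma exists_equiv_initSeg_of_isChain (hn : Fintype.card R = n) (𝒞 : Finset (Finset R))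
    (h𝒞 : IsChain (· ⊆ ·) (𝒞 : Set (Finset R))) :
    ∃ f : R ≃ Fin n, ∀ D ∈ 𝒞, ∃ k, D = initSeg f k := by
  classical
  obtain ⟨f, hf⟩ := exists_equiv_lt_of_lt hn fun a => (𝒞.filter fun D => a ∉ D).card
  refine ⟨f, fun D hD => exists_eq_initSeg f D fun a ha b hb => hf a b ?_⟩
  refine Finset.card_lt_card (Finset.ssubset_iff_of_subset (fun E hE => ?_) |>.2
    ⟨D, by simp [hD, hb], by simp [ha]⟩)
  obtain ⟨hE, haE⟩ := Finset.mem_filter.1 hE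
  refine Finset.mem_filter.2 ⟨hE, fun hbE => ?_⟩
  rcases h𝒞.total hD hE with h | h
  · exact haE (h ha)
  · exact hb (h hbE)

lemma initSeg_trans_swap (f : R ≃ Fin n) {i j : Fin n} {k : Fin (n + 1)}
    (h : (i : ℕ) < k ↔ (j : ℕ) < k) :
    initSeg (f.trans (Equiv.swap i j)) k = initSeg f k := by
  ext a
  simp only [mem_initSeg, Equiv.trans_apply, Equiv.swap_apply_def]
  split_ifs with h1 h2
  · rw [h1, h]
  · rw [h2, h]
  · rfl

/-- Two orderings of the colors have the same initial segments in all sizes but one. -/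
def OrderAdj (f g : R ≃ Fin n) : Prop :=
  ∃ m, initSeg f m ≠ initSeg g m ∧ ∀ k, k ≠ m → initSeg f k = initSeg g k

lemma orderAdj_trans_swap (f : R ≃ Fin n) {i j : Fin n} (hij : (j : ℕ) = i + 1) :
    OrderAdj f (f.trans (Equiv.swap i j)) := by
  refine ⟨j.castSucc, fun h => ?_, fun k hk => (initSeg_trans_swap f ?_).symm⟩
  · have : f.symm i ∈ initSeg f j.castSucc := by simp [hij]
    rw [h] at this
    simp at this
  · have : (k : ℕ) ≠ j := fun h => hk (Fin.ext h)
    omega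

lemma reflTransGen_orderAdj (J : Set (Fin (n + 1))) (g f : R ≃ Fin n)
    (hf : ∀ k ∈ J, initSeg f k = initSeg g k) :
    ReflTransGen (fun f f' => OrderAdj f f' ∧ ∀ k ∈ J, initSeg f' k = initSeg g k) f g := by
  classical
  let inv (f : R ≃ Fin n) : Finset (R × R) :=
    Finset.univ.filter fun p => f p.1 < f p.2 ∧ g p.2 < g p.1
  induction hN : (inv f).card using Nat.strong_induction_on generalizing f with
  | _ N ih =>
  subst hN
  by_cases hfg : f = g
  · rw [hfg]
  obtain ⟨i, j, hij, hinv⟩ := exists_adjacent_inversion hfg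
  have hagree : ∀ k ∈ J, initSeg (f.trans (Equiv.swap i j)) k = initSeg g k := by
    intro k hk
    rw [← hf k hk]
    refine initSeg_trans_swap f ⟨fun hik => ?_, fun hjk => by omega⟩
    by_contra hjk
    have h1 : f.symm i ∈ initSeg f k := by simpa using hik
    have h2 : f.symm j ∉ initSeg f k := by simpa using hjk
    rw [hf k hk, mem_initSeg] at h1 h2
    omega
  suffices hlt : (inv (f.trans (Equiv.swap i j))).card < (inv f).card from
    ReflTransGen.head ⟨orderAdj_trans_swap f hij, hagree⟩ (ih _ hlt _ hagree rfl)
  refine Finset.card_lt_card (Finset.ssubset_iff_of_subset (fun p hp => ?_) |>.2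
    ⟨(f.symm i, f.symm j), ?_, ?_⟩)
  · obtain ⟨hlt, hg⟩ := (Finset.mem_filter.1 hp).2
    refine Finset.mem_filter.2 ⟨Finset.mem_univ _, ?_, hg⟩
    by_contra hle
    have key : f p.1 = j ∧ f p.2 = i := by
      simp only [Equiv.trans_apply, Equiv.swap_apply_def] at hlt
      split_ifs at hlt <;> constructor <;> omega
    rw [← key.1, ← key.2, f.symm_apply_apply, f.symm_apply_apply] at hinv
    exact hinv.asymm hg
  · simp only [inv, Finset.mem_filter, Finset.mem_univ, true_and, Equiv.apply_symm_apply]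
    exact ⟨by omega, hinv⟩
  · intro hmem
    have hlt := (Finset.mem_filter.1 hmem).2.1
    simp only [Equiv.trans_apply, Equiv.apply_symm_apply, Equiv.swap_apply_left,
      Equiv.swap_apply_right] at hlt
    omega

end InitialSegments

section Flags

variable [Fintype R] {n : ℕ} (G : SimpleGraph V) (c : V → V → R)

/-- The face of rank `k` in the flag given by the vertex `p.1` and the color ordering `p.2`. -/
def flagFace (p : V × (R ≃ Fin n)) (k : Fin (n + 1)) : ColorfulFace G c :=
  mkFace G c (initSeg p.2 k) p.1

/-- The flag given by a vertex and an ordering of the colors. -/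
def flagOf (p : V × (R ≃ Fin n)) : Set (ColorfulFace G c) :=
  Set.range (flagFace G c p)

variable {G c}

lemma faceRank_flagFace (p : V × (R ≃ Fin n)) (k : Fin (n + 1)) :
    faceRank G c (flagFace G c p k) = k := by
  rw [flagFace, faceRank_mkFace, card_initSeg]

lemma index_eq_of_flagFace_eq {p q : V × (R ≃ Fin n)} {k l : Fin (n + 1)}
    (h : flagFace G c p k = flagFace G c q l) : k = l := by
  have := congrArg (faceRank G c) h
  rw [faceRank_flagFace, faceRank_flagFace] at this
  exact Fin.ext this

lemma flagFace_mono (p : V × (R ≃ Fin n)) : Monotone (flagFace G c p) := fun _ _ hkl =>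
  mkFace_le_iff.2 ⟨initSeg_mono p.2 hkl, SimpleGraph.Reachable.refl _⟩

lemma isMaxChain_flagOf (p : V × (R ≃ Fin n)) : IsMaxChain (· ≤ ·) (flagOf G c p) := by
  have hchain : IsChain (· ≤ ·) (flagOf G c p) := (flagFace_mono p).isChain_range
  refine ⟨hchain, fun S hS hsub => hsub.antisymm fun x hx => ?_⟩
  have hcard : faceRank G c x < n + 1 := by
    obtain ⟨D, w, rfl⟩ := exists_eq_mkFace x
    have := Finset.card_le_univ D
    rw [Fintype.card_congr p.2, Fintype.card_fin] at this
    rw [faceRank_mkFace]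
    omega
  have hk := faceRank_flagFace (G := G) (c := c) p ⟨_, hcard⟩
  refine ⟨⟨_, hcard⟩, ?_⟩
  rcases hS.total (hsub ⟨⟨_, hcard⟩, rfl⟩) hx with h | h
  · exact eq_of_le_of_faceRank_le h hk.ge
  · exact (eq_of_le_of_faceRank_le h hk.le).symm

lemma exists_eq_flagOf [Nonempty V] (hn : Fintype.card R = n) {Φ : Set (ColorfulFace G c)}
    (hΦ : IsMaxChain (· ≤ ·) Φ) : ∃ p : V × (R ≃ Fin n), Φ = flagOf G c p := by
  classical
  suffices h : ∃ p : V × (R ≃ Fin n), Φ ⊆ flagOf G c p by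
    obtain ⟨p, hp⟩ := h
    exact ⟨p, hΦ.2 (isMaxChain_flagOf p).1 hp⟩
  rcases Φ.eq_empty_or_nonempty with rfl | hne
  · obtain ⟨v⟩ := ‹Nonempty V›
    exact ⟨(v, Fintype.equivFinOfCardEq hn), Set.empty_subset _⟩
  obtain ⟨x, hx, hmin⟩ := (measure (faceRank G c)).wf.has_min Φ hne
  obtain ⟨C, v, rfl⟩ := exists_eq_mkFace x
  have hle : ∀ y ∈ Φ, mkFace G c C v ≤ y := fun y hy => by
    rcases hΦ.1.total hx hy with h | h
    · exact h
    · exact (eq_of_le_of_faceRank_le h (not_lt.1 (hmin y hy))).ge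
  obtain ⟨f, hf⟩ := exists_equiv_initSeg_of_isChain hn
    (Finset.univ.filter fun D => mkFace G c D v ∈ Φ) (by
      intro D hD E hE _
      simp only [Finset.coe_filter, Finset.mem_univ, true_and, Set.mem_ofPred_eq] at hD hE
      exact (hΦ.1.total hD hE).imp (fun h => (mkFace_le_iff.1 h).1)
        fun h => (mkFace_le_iff.1 h).1)
  refine ⟨(v, f), fun y hy => ?_⟩
  obtain ⟨D, w, rfl⟩ := exists_eq_mkFace y
  have hw : mkFace G c D v = mkFace G c D w :=
    mkFace_eq_iff.2 ⟨rfl, (mkFace_le_iff.1 (hle _ hy)).2⟩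
  obtain ⟨k, rfl⟩ := hf D (Finset.mem_filter.2 ⟨Finset.mem_univ _, hw ▸ hy⟩)
  exact ⟨k, hw⟩

/-- Two vertex-ordering pairs give flags differing in exactly one rank. -/
def PairAdj (G : SimpleGraph V) (c : V → V → R) (p q : V × (R ≃ Fin n)) : Prop :=
  ∃ m, flagFace G c p m ≠ flagFace G c q m ∧
    ∀ k, k ≠ m → flagFace G c p k = flagFace G c q k

lemma PairAdj.symm {p q : V × (R ≃ Fin n)} (h : PairAdj G c p q) : PairAdj G c q p := by
  obtain ⟨m, hm, hk⟩ := h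
  exact ⟨m, hm.symm, fun k hkm => (hk k hkm).symm⟩

lemma PairAdj.ncard_sdiff {p q : V × (R ≃ Fin n)} (h : PairAdj G c p q) :
    (flagOf G c p \ flagOf G c q).ncard = 1 := by
  obtain ⟨m, hm, hk⟩ := h
  refine Set.ncard_eq_one.2 ⟨flagFace G c p m,
    Set.eq_singleton_iff_unique_mem.2 ⟨⟨⟨m, rfl⟩, ?_⟩, ?_⟩⟩
  · rintro ⟨k, hkm⟩
    obtain rfl := index_eq_of_flagFace_eq hkm
    exact hm hkm.symm
  · rintro _ ⟨⟨k, rfl⟩, hkq⟩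
    by_contra hne
    exact hkq ⟨k, (hk k fun h => hne (h ▸ rfl)).symm⟩

lemma OrderAdj.pairAdj {f g : R ≃ Fin n} (h : OrderAdj f g) (v : V) :
    PairAdj G c (v, f) (v, g) := by
  obtain ⟨m, hm, hk⟩ := h
  exact ⟨m, fun h => hm (mkFace_eq_iff.1 h).1, fun k hkm => by simp only [flagFace, hk k hkm]⟩

/-- Crossing an edge of the first color changes only the vertex of a flag. -/
lemma pairAdj_of_adj {f : R ≃ Fin n} {u v : V} {a : R} (ha : (f a : ℕ) = 0)
    (huv : (colorSub G c {a}).Adj u v) : PairAdj G c (u, f) (v, f) := by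
  refine ⟨0, fun h => huv.ne ?_, fun k hk => mkFace_eq_iff.2 ⟨rfl, ?_⟩⟩
  · have h0 : initSeg f 0 = ∅ := by
      ext
      simp
    have := (mkFace_eq_iff.1 h).2
    rwa [h0, cEquiv_empty_iff] at this
  · refine cEquiv_mono G c ?_ huv.reachable
    rw [Finset.singleton_subset_iff, mem_initSeg, ha]
    exact Fin.pos_of_ne_zero hk

/-- A color in an initial segment can be moved to the front without changing larger segments. -/
lemma exists_equiv_val_eq_zero (f : R ≃ Fin n) {j : Fin (n + 1)} {a : R}
    (ha : a ∈ initSeg f j) :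
    ∃ f' : R ≃ Fin n, (f' a : ℕ) = 0 ∧ ∀ k, j ≤ k → initSeg f' k = initSeg f k := by
  have hpos : 0 < n := (Nat.zero_le _).trans_lt (f a).isLt
  rw [mem_initSeg] at ha
  refine ⟨f.trans (Equiv.swap (f a) ⟨0, hpos⟩), by simp, fun k hk => ?_⟩
  refine initSeg_trans_swap f ?_
  have : (j : ℕ) ≤ k := hk
  simp only
  omega

lemma reflTransGen_pairAdj {J : Set (Fin (n + 1))} {j : Fin (n + 1)} (hj : j ∈ J)
    (hmin : ∀ k ∈ J, j ≤ k) {w : V} {g : R ≃ Fin n} {u : V}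
    (huw : cEquiv G c (initSeg g j) u w) (f : R ≃ Fin n)
    (hf : ∀ k ∈ J, initSeg f k = initSeg g k) :
    ReflTransGen (fun p q => PairAdj G c p q ∧
      ∀ k ∈ J, flagFace G c q k = flagFace G c (w, g) k) (u, f) (w, g) := by
  have reorder : ∀ {x : V} {h h' : R ≃ Fin n}, cEquiv G c (initSeg g j) x w →
      (∀ k ∈ J, initSeg h k = initSeg g k) → (∀ k ∈ J, initSeg h' k = initSeg g k) →
      ReflTransGen (fun p q => PairAdj G c p q ∧
        ∀ k ∈ J, flagFace G c q k = flagFace G c (w, g) k) (x, h) (x, h') := by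
    intro x h h' hx hh hh'
    refine (reflTransGen_orderAdj J h' h fun k hk => (hh k hk).trans (hh' k hk).symm).lift
      (fun e => (x, e)) fun e e' he => ⟨he.1.pairAdj x, fun k hk => ?_⟩
    have := (he.2 k hk).trans (hh' k hk)
    exact mkFace_eq_iff.2
      ⟨this, cEquiv_mono G c (this ▸ initSeg_mono g (hmin k hk)) hx⟩
  obtain ⟨walk⟩ := huw
  induction walk generalizing f with
  | nil => exact reorder (SimpleGraph.Reachable.refl _) hf fun _ _ => rfl
  | @cons u v w hadj walk ih =>
    obtain ⟨a, ha, hadj'⟩ := exists_color_of_adj hadj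
    rw [← hf j hj] at ha
    obtain ⟨f', hf'0, hf'⟩ := exists_equiv_val_eq_zero f ha
    have hf'g : ∀ k ∈ J, initSeg f' k = initSeg g k := fun k hk =>
      (hf' k (hmin k hk)).trans (hf k hk)
    refine (reorder (hadj.reachable.trans walk.reachable) hf hf'g).trans
      (ReflTransGen.head ⟨pairAdj_of_adj hf'0 hadj', fun k hk => ?_⟩ (ih f' hf'g reorder))
    exact mkFace_eq_iff.2 ⟨hf'g k hk, cEquiv_mono G c
      ((initSeg_mono g (hmin k hk)).trans (hf'g k hk).ge) walk.reachable⟩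

end Flags

lemma exists_seq_of_reflTransGen {α : Type*} {r : α → α → Prop} {a b : α}
    (h : ReflTransGen r a b) :
    ∃ (l : ℕ) (s : Fin (l + 1) → α), s 0 = a ∧ s (Fin.last l) = b ∧
      ∀ i : Fin l, r (s i.castSucc) (s i.succ) := by
  induction h using ReflTransGen.head_induction_on with
  | refl => exact ⟨0, fun _ => b, rfl, rfl, fun i => i.elim0⟩
  | @head a a' haa' _ ih =>
    obtain ⟨l, s, h0, hl, hs⟩ := ih
    refine ⟨l + 1, Fin.cons a s, rfl, by rw [← Fin.succ_last, Fin.cons_succ, hl], ?_⟩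
    refine Fin.cases ?_ fun i => ?_
    · simpa [h0] using haa'
    · rw [← Fin.succ_castSucc, Fin.cons_succ, Fin.cons_succ]
      exact hs i

/-- `P_G` is strongly flag-connected: any two flags `Φ`, `Ψ` are joined by a
sequence of flags `Φ = Φ_0, Φ_1, …, Φ_l = Ψ` in which consecutive flags differ in exactly
one face and every flag of the sequence contains `Φ ∩ Ψ`. -/
theorem colorful_strongly_flag_connected
    {V R : Type*} [Fintype V] [Fintype R] [DecidableEq R]
    (G : SimpleGraph V) (hconn : G.Connected) (c : V → V → R)
    (hc : IsProperColoring G c) (Φ Ψ : Set (ColorfulFace G c))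
    (hΦ : IsMaxChain (· ≤ ·) Φ) (hΨ : IsMaxChain (· ≤ ·) Ψ) :
    ∃ (l : ℕ) (seq : Fin (l + 1) → Set (ColorfulFace G c)),
      seq 0 = Φ ∧ seq (Fin.last l) = Ψ ∧
      (∀ i, IsMaxChain (· ≤ ·) (seq i)) ∧
      (∀ i, Φ ∩ Ψ ⊆ seq i) ∧
      (∀ i : Fin l,
        (seq i.castSucc \ seq i.succ).ncard = 1 ∧ (seq i.succ \ seq i.castSucc).ncard = 1) := by
  classical
  have := hconn.nonempty
  obtain ⟨⟨v, f⟩, rfl⟩ := exists_eq_flagOf rfl hΦ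
  obtain ⟨⟨w, g⟩, rfl⟩ := exists_eq_flagOf rfl hΨ
  let J : Set (Fin (Fintype.card R + 1)) :=
    {k | flagFace G c (v, f) k = flagFace G c (w, g) k}
  have hlast : Fin.last _ ∈ J := by
    have huniv : ∀ h : R ≃ Fin (Fintype.card R), initSeg h (Fin.last _) = Finset.univ := by
      intro h
      ext a
      simp
    refine mkFace_eq_iff.2 ⟨by simp only [huniv], ?_⟩
    simp only [huniv]
    exact cEquiv_univ hconn v w
  obtain ⟨j, hj, hmin⟩ := wellFounded_lt.has_min J ⟨_, hlast⟩
  obtain ⟨hfg, hvw⟩ := mkFace_eq_iff.1 hj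
  have hpath := reflTransGen_pairAdj hj (fun k hk => not_lt.1 (hmin k hk)) (hfg ▸ hvw) f
    fun k hk => (mkFace_eq_iff.1 hk).1
  obtain ⟨l, s, h0, hl, hs⟩ := exists_seq_of_reflTransGen hpath
  refine ⟨l, fun i => flagOf G c (s i), by simp only [h0], by simp only [hl],
    fun i => isMaxChain_flagOf _, fun i => ?_,
    fun i => ⟨(hs i).1.ncard_sdiff, (hs i).1.symm.ncard_sdiff⟩⟩
  have hcommon : ∀ k ∈ J, flagFace G c (s i) k = flagFace G c (w, g) k := by
    induction i using Fin.cases with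
    | zero => rw [h0]; exact fun k hk => hk
    | succ i => exact (hs i).2
  rintro _ ⟨⟨k, rfl⟩, ⟨k', hk'⟩⟩
  obtain rfl := index_eq_of_flagFace_eq hk'
  exact ⟨k', (hcommon k' hk'.symm).trans hk'⟩
end

section
/- Every order automorphism α of P_G preserves ranks of faces and its restriction to the rank-0 and rank-1 faces (identified with the vertices and edges of G via v ↦ (∅,v)) is a color respecting graph automorphism of G; moreover the resulting restriction map Aut(P_G) → Γ_c(G) is a group isomorphism, whose inverse sends γ ∈ Γ_c(G) to the order automorphism (C,v) ↦ (̄γ(C), γ(v)). In particular the automorphism group of the colorful polytope P_G equals the group Γ_c(G) of color respecting automorphisms of G. -/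
open SimpleGraph

variable {V R : Type*}

/-- A graph automorphism `γ` of `G` is color respecting if any two edges with the same
color are mapped to edges with the same color. -/
def ColorResp {V R : Type*} (G : SimpleGraph V) (c : V → V → R) (γ : G ≃g G) : Prop :=
  ∀ v w v' w' : V, G.Adj v w → G.Adj v' w' → c v w = c v' w' →
    c (γ v) (γ w) = c (γ v') (γ w')

lemma colorSub_adj_iff {G : SimpleGraph V} {c : V → V → R} (hc : IsProperColoring G c)
    {C : Finset R} {v w : V} : (colorSub G c C).Adj v w ↔ G.Adj v w ∧ c v w ∈ C := by
  constructor
  · rintro ⟨_, h | ⟨h, h'⟩⟩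
    · exact h
    · exact ⟨h.symm, hc.symm _ _ h ▸ h'⟩
  · exact fun h => ⟨h.1.ne, Or.inl h⟩

lemma mkFace_le_mkFace {G : SimpleGraph V} {c : V → V → R} {C D : Finset R} {v w : V} :
    mkFace G c C v ≤ mkFace G c D w ↔ C ⊆ D ∧ cEquiv G c D v w :=
  Iff.rfl

lemma mkFace_eq_mkFace {G : SimpleGraph V} {c : V → V → R} {C D : Finset R} {v w : V} :
    mkFace G c C v = mkFace G c D w ↔ C = D ∧ cEquiv G c C v w :=
  Quotient.eq (r := faceSetoid G c)

lemma exists_mkFace_eq {G : SimpleGraph V} {c : V → V → R} (x : ColorfulFace G c) :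
    ∃ C v, mkFace G c C v = x :=
  Quotient.inductionOn x fun p => ⟨p.1, p.2, rfl⟩

lemma mkFace_le_mkFace_same {G : SimpleGraph V} {c : V → V → R} {C D : Finset R} {v : V} :
    mkFace G c C v ≤ mkFace G c D v ↔ C ⊆ D :=
  mkFace_le_mkFace.trans (and_iff_left (SimpleGraph.Reachable.refl _))

lemma mkFace_left_injective (G : SimpleGraph V) (c : V → V → R) (v : V) :
    Function.Injective fun C => mkFace G c C v :=
  fun _ _ h => (mkFace_eq_mkFace.1 h).1

lemma eq_of_cEquiv_empty {G : SimpleGraph V} {c : V → V → R} {v w : V}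
    (h : cEquiv G c ∅ v w) : v = w := by
  obtain ⟨p⟩ := h
  cases p with
  | nil => rfl
  | cons h _ => obtain ⟨_, h | h⟩ := h <;> simp at h

lemma mkFace_empty_injective (G : SimpleGraph V) (c : V → V → R) :
    Function.Injective (mkFace G c ∅) :=
  fun _ _ h => eq_of_cEquiv_empty (mkFace_eq_mkFace.1 h).2

/-- With a single color available, an equivalence class has at most one edge. -/
lemma cEquiv_singleton {G : SimpleGraph V} {c : V → V → R} (hc : IsProperColoring G c)
    {s : R} {v w : V} (h : cEquiv G c {s} v w) : v = w ∨ G.Adj v w ∧ c v w = s := by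
  obtain ⟨p⟩ := h
  induction p with
  | nil => exact Or.inl rfl
  | @cons u v w h _ ih =>
    rw [colorSub_adj_iff hc, Finset.mem_singleton] at h
    obtain rfl | ⟨h₁, h₂⟩ := ih
    · exact Or.inr h
    · refine Or.inl ((hc.bijOn v).injOn h.1.symm h₁ ?_)
      exact (hc.symm _ _ h.1).symm.trans (h.2.trans h₂.symm)

lemma mkFace_eq_of_adj {G : SimpleGraph V} {c : V → V → R} (hc : IsProperColoring G c)
    {C : Finset R} {v w : V} (h : G.Adj v w) (hC : c v w ∈ C) :
    mkFace G c C v = mkFace G c C w :=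
  mkFace_eq_mkFace.2 ⟨rfl, ((colorSub_adj_iff hc).2 ⟨h, hC⟩).reachable⟩

lemma isMin_iff_exists_mkFace_empty {G : SimpleGraph V} {c : V → V → R}
    {x : ColorfulFace G c} : IsMin x ↔ ∃ v, mkFace G c ∅ v = x := by
  obtain ⟨C, v, rfl⟩ := exists_mkFace_eq x
  constructor
  · intro h
    exact ⟨v, le_antisymm (mkFace_le_mkFace_same.2 C.empty_subset)
      (h (mkFace_le_mkFace_same.2 C.empty_subset))⟩
  · rintro ⟨w, hw⟩ y hy
    rw [← hw] at hy ⊢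
    obtain ⟨D, u, rfl⟩ := exists_mkFace_eq y
    obtain ⟨h₁, h₂⟩ := mkFace_le_mkFace.1 hy
    rw [Finset.subset_empty.1 h₁, eq_of_cEquiv_empty h₂]

lemma exists_eq_mkFace_of_mkFace_empty_le {G : SimpleGraph V} {c : V → V → R}
    {x : ColorfulFace G c} {v : V} (h : mkFace G c ∅ v ≤ x) : ∃ C, x = mkFace G c C v := by
  obtain ⟨C, w, rfl⟩ := exists_mkFace_eq x
  exact ⟨C, (mkFace_eq_mkFace.2 ⟨rfl, (mkFace_le_mkFace.1 h).2⟩).symm⟩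

/-- Every order automorphism of a power set is induced by a permutation. -/
lemma Finset.exists_perm_orderIso_eq_image [DecidableEq R] (φ : Finset R ≃o Finset R) :
    ∃ σ : Equiv.Perm R, ∀ C, φ C = C.image σ := by
  have key : ∀ (ψ : Finset R ≃o Finset R) (r : R), ∃ s, ψ {r} = {s} := fun ψ r =>
    Finset.isAtom_iff.1 ((OrderIso.isAtom_iff ψ _).2 (Finset.isAtom_singleton r))
  choose f hf using key φ
  choose g hg using key φ.symm
  have hgf : ∀ r, g (f r) = r := fun r => by
    rw [← Finset.singleton_inj, ← hg, ← hf, φ.symm_apply_apply]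
  have hfg : ∀ r, f (g r) = r := fun r => by
    rw [← Finset.singleton_inj, ← hf, ← hg, φ.apply_symm_apply]
  refine ⟨⟨f, g, hgf, hfg⟩, fun C => ?_⟩
  ext x
  rw [← Finset.singleton_subset_iff, ← φ.symm_apply_le, hg,
    Finset.singleton_subset_iff, Finset.mem_image]
  exact ⟨fun h => ⟨_, h, hfg x⟩, by rintro ⟨r, hr, rfl⟩; exact (hgf r).symm ▸ hr⟩

lemma exists_apply_mkFace_empty {G : SimpleGraph V} {c : V → V → R}
    (α : ColorfulFace G c ≃o ColorfulFace G c) (v : V) :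
    ∃ w, α (mkFace G c ∅ v) = mkFace G c ∅ w := by
  obtain ⟨w, hw⟩ := isMin_iff_exists_mkFace_empty.1
    (α.isMin_apply.2 (isMin_iff_exists_mkFace_empty.2 ⟨v, rfl⟩))
  exact ⟨w, hw.symm⟩

/-- An order automorphism acts on the faces above a vertex through a permutation of colors. -/
lemma exists_perm_apply_mkFace [DecidableEq R] {G : SimpleGraph V} {c : V → V → R}
    (α : ColorfulFace G c ≃o ColorfulFace G c) {v w : V}
    (h : α (mkFace G c ∅ v) = mkFace G c ∅ w) :
    ∃ σ : Equiv.Perm R, ∀ C, α (mkFace G c C v) = mkFace G c (C.image σ) w := by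
  have h₁ : ∀ C, ∃ D, α (mkFace G c C v) = mkFace G c D w := fun C =>
    exists_eq_mkFace_of_mkFace_empty_le
      (h ▸ α.monotone (mkFace_le_mkFace_same.2 C.empty_subset))
  have h₂ : ∀ C, ∃ D, α.symm (mkFace G c C w) = mkFace G c D v := fun C =>
    exists_eq_mkFace_of_mkFace_empty_le
      (by rw [← α.symm_apply_apply (mkFace G c ∅ v), h]
          exact α.symm.monotone (mkFace_le_mkFace_same.2 C.empty_subset))
  choose f hf using h₁
  choose g hg using h₂
  let φ : Finset R ≃o Finset R :=
    { toFun := f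
      invFun := g
      left_inv := fun C => mkFace_left_injective G c v
        (by simp only [← hg, ← hf, α.symm_apply_apply])
      right_inv := fun C => mkFace_left_injective G c w
        (by simp only [← hg, ← hf, α.apply_symm_apply])
      map_rel_iff' := fun {C D} => by
        change f C ⊆ f D ↔ C ⊆ D
        rw [← mkFace_le_mkFace_same (G := G) (c := c) (v := w), ← hf, ← hf,
          α.le_iff_le, mkFace_le_mkFace_same] }
  obtain ⟨σ, hσ⟩ := Finset.exists_perm_orderIso_eq_image φ
  exact ⟨σ, fun C => hσ C ▸ hf C⟩

lemma faceRank_orderIso_apply [DecidableEq R] {G : SimpleGraph V} {c : V → V → R}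
    (α : ColorfulFace G c ≃o ColorfulFace G c) (x : ColorfulFace G c) :
    faceRank G c (α x) = faceRank G c x := by
  obtain ⟨C, v, rfl⟩ := exists_mkFace_eq x
  obtain ⟨w, hw⟩ := exists_apply_mkFace_empty α v
  obtain ⟨σ, hσ⟩ := exists_perm_apply_mkFace α hw
  rw [hσ]
  exact Finset.card_image_of_injective C σ.injective

/-- The permutations of colors at the two ends of an edge agree. -/
lemma perm_eq_of_adj [DecidableEq R] {G : SimpleGraph V} {c : V → V → R}
    (hc : IsProperColoring G c) (α : ColorfulFace G c ≃o ColorfulFace G c)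
    {v w v' w' : V} {σ τ : Equiv.Perm R}
    (hσ : ∀ C, α (mkFace G c C v) = mkFace G c (C.image σ) v')
    (hτ : ∀ C, α (mkFace G c C w) = mkFace G c (C.image τ) w')
    (h : G.Adj v w) : σ = τ := by
  have key : ∀ C : Finset R, c v w ∈ C → C.image σ = C.image τ := fun C hC =>
    (mkFace_eq_mkFace.1 ((hσ C).symm.trans
      ((congrArg α (mkFace_eq_of_adj hc h hC)).trans (hτ C)))).1
  have hs : σ (c v w) = τ (c v w) := by simpa using key {c v w} (by simp)
  ext r
  have hr : σ r ∈ ({c v w, r} : Finset R).image τ := by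
    rw [← key _ (by simp)]; simp
  simp only [Finset.image_insert, Finset.image_singleton, Finset.mem_insert,
    Finset.mem_singleton] at hr
  obtain hr | hr := hr
  · rw [← hs] at hr
    rw [σ.injective hr, hs]
  · exact hr

lemma exists_iso_perm_of_orderIso [DecidableEq R] {G : SimpleGraph V} (hconn : G.Connected)
    {c : V → V → R} (hc : IsProperColoring G c) (α : ColorfulFace G c ≃o ColorfulFace G c) :
    ∃ (γ : G ≃g G) (σ : Equiv.Perm R),
      (∀ v w, G.Adj v w → c (γ v) (γ w) = σ (c v w)) ∧
      ∀ C v, α (mkFace G c C v) = mkFace G c (C.image σ) (γ v) := by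
  choose f hf using exists_apply_mkFace_empty α
  choose g hg using exists_apply_mkFace_empty α.symm
  choose τ hτ using fun v => exists_perm_apply_mkFace α (hf v)
  have hgf : ∀ v, g (f v) = v := fun v => mkFace_empty_injective G c
    (by rw [← hg, ← hf, α.symm_apply_apply])
  have hfg : ∀ v, f (g v) = v := fun v => mkFace_empty_injective G c
    (by rw [← hf, ← hg, α.apply_symm_apply])
  have hconst : ∀ v w, τ v = τ w := fun v w => by
    obtain ⟨p⟩ := hconn.preconnected v w
    induction p with
    | nil => rfl
    | cons h _ ih => exact (perm_eq_of_adj hc α (hτ _) (hτ _) h).trans ih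
  obtain ⟨v₀⟩ := hconn.nonempty
  have hα : ∀ C v, α (mkFace G c C v) = mkFace G c (C.image (τ v₀)) (f v) := fun C v => by
    rw [hτ, hconst v v₀]
  have hadj : ∀ v w, G.Adj v w →
      G.Adj (f v) (f w) ∧ c (f v) (f w) = τ v₀ (c v w) := fun v w h => by
    have h' := congrArg α (mkFace_eq_of_adj hc h (Finset.mem_singleton_self _))
    rw [hα, hα, mkFace_eq_mkFace, Finset.image_singleton] at h'
    refine (cEquiv_singleton hc h'.2).resolve_left fun he => h.ne ?_
    rw [← hgf v, he, hgf]
  refine ⟨⟨⟨f, g, hgf, hfg⟩, fun {v w} => ⟨fun h => ?_, fun h => (hadj v w h).1⟩⟩, τ v₀,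
    fun v w h => (hadj v w h).2, hα⟩
  change G.Adj (f v) (f w) at h
  have h' : α (mkFace G c {(τ v₀).symm (c (f v) (f w))} v)
      = α (mkFace G c {(τ v₀).symm (c (f v) (f w))} w) := by
    rw [hα, hα]
    exact mkFace_eq_of_adj hc h (by simp)
  refine ((cEquiv_singleton hc (mkFace_eq_mkFace.1 (α.injective h')).2).resolve_left ?_).1
  rintro rfl
  exact h.ne rfl

lemma cEquiv_image [DecidableEq R] {G : SimpleGraph V} {c : V → V → R}
    (hc : IsProperColoring G c) {γ : G ≃g G} {σ : Equiv.Perm R}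
    (h : ∀ v w, G.Adj v w → c (γ v) (γ w) = σ (c v w)) {C : Finset R} {v w : V}
    (hvw : cEquiv G c C v w) : cEquiv G c (C.image σ) (γ v) (γ w) := by
  refine SimpleGraph.Reachable.map (G' := colorSub G c (C.image σ)) ⟨γ, fun {a b} hab => ?_⟩ hvw
  rw [colorSub_adj_iff hc] at hab ⊢
  exact ⟨γ.map_rel_iff.2 hab.1, h a b hab.1 ▸ Finset.mem_image_of_mem σ hab.2⟩

lemma exists_orderIso_of_iso_perm [DecidableEq R] {G : SimpleGraph V} {c : V → V → R}
    (hc : IsProperColoring G c) {γ : G ≃g G} {σ : Equiv.Perm R}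
    (h : ∀ v w, G.Adj v w → c (γ v) (γ w) = σ (c v w)) :
    ∃ α : ColorfulFace G c ≃o ColorfulFace G c,
      ∀ C v, α (mkFace G c C v) = mkFace G c (C.image σ) (γ v) := by
  have main : ∀ (γ : G ≃g G) (σ : Equiv.Perm R),
      (∀ v w, G.Adj v w → c (γ v) (γ w) = σ (c v w)) →
      ∃ f : ColorfulFace G c →o ColorfulFace G c,
        ∀ C v, f (mkFace G c C v) = mkFace G c (C.image σ) (γ v) := fun γ σ h => by
    refine ⟨⟨Quotient.lift (fun p => mkFace G c (p.1.image σ) (γ p.2)) ?_, ?_⟩,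
      fun _ _ => rfl⟩
    · rintro ⟨C, v⟩ ⟨D, w⟩ ⟨hCD, hvw⟩
      exact mkFace_eq_mkFace.2 ⟨congrArg _ hCD, cEquiv_image hc h hvw⟩
    · refine Quotient.ind fun p => Quotient.ind fun q => ?_
      rintro ⟨hpq, hvw⟩
      exact mkFace_le_mkFace.2 ⟨Finset.image_subset_image hpq, cEquiv_image hc h hvw⟩
  obtain ⟨f, hf⟩ := main γ σ h
  obtain ⟨g, hg⟩ := main γ.symm σ.symm fun v w hvw => by
    rw [Equiv.eq_symm_apply, ← h _ _ (γ.symm.map_rel_iff.2 hvw), γ.apply_symm_apply,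
      γ.apply_symm_apply]
  refine ⟨OrderIso.ofHomInv f g (OrderHom.ext _ _ (funext fun x => ?_))
    (OrderHom.ext _ _ (funext fun x => ?_)), hf⟩
  all_goals
    obtain ⟨C, v, rfl⟩ := exists_mkFace_eq x
    simp [hf, hg, Finset.image_image]

/-- every order automorphism `α` of `P_G` preserves ranks and is induced by a
unique pair `(γ, σ)` of a color respecting automorphism `γ` of `G` (the restriction of `α`
to the 1-skeleton) together with its color permutation `σ`, acting by
`(C,v) ↦ (σ(C), γ(v))`; conversely each color respecting automorphism arises this way.
Hence `Aut(P_G) = Γ_c(G)`. -/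
theorem colorful_automorphism_group_eq_color_respecting
    {V R : Type*} [Fintype V] [Fintype R] [DecidableEq R]
    (G : SimpleGraph V) (hconn : G.Connected) (c : V → V → R)
    (hc : IsProperColoring G c) :
    (∀ (α : ColorfulFace G c ≃o ColorfulFace G c) (x : ColorfulFace G c),
      faceRank G c (α x) = faceRank G c x) ∧
    (∀ α : ColorfulFace G c ≃o ColorfulFace G c,
      ∃! γσ : (G ≃g G) × Equiv.Perm R,
        ColorResp G c γσ.1 ∧
        (∀ v w : V, G.Adj v w → c (γσ.1 v) (γσ.1 w) = γσ.2 (c v w)) ∧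
        (∀ (C : Finset R) (v : V),
          α (mkFace G c C v) = mkFace G c (C.image γσ.2) (γσ.1 v))) ∧
    (∀ (γ : G ≃g G) (σ : Equiv.Perm R), ColorResp G c γ →
      (∀ v w : V, G.Adj v w → c (γ v) (γ w) = σ (c v w)) →
      ∃ α : ColorfulFace G c ≃o ColorfulFace G c,
        ∀ (C : Finset R) (v : V),
          α (mkFace G c C v) = mkFace G c (C.image σ) (γ v)) := by
  refine ⟨faceRank_orderIso_apply, fun α => ?_,
    fun γ σ _ h => exists_orderIso_of_iso_perm hc h⟩
  obtain ⟨γ, σ, hcol, hα⟩ := exists_iso_perm_of_orderIso hconn hc α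
  refine ⟨(γ, σ), ⟨?_, hcol, hα⟩, ?_⟩
  · intro v w v' w' h h' he
    rw [hcol _ _ h, hcol _ _ h', he]
  · rintro ⟨γ', σ'⟩ ⟨-, -, hα'⟩
    have key : ∀ (C : Finset R) (v : V),
        mkFace G c (C.image σ') (γ' v) = mkFace G c (C.image σ) (γ v) :=
      fun C v => (hα' C v).symm.trans (hα C v)
    obtain ⟨v₀⟩ := hconn.nonempty
    refine Prod.ext (RelIso.ext fun v => mkFace_empty_injective G c ?_) (Equiv.ext fun r => ?_)
    · simpa using key ∅ v
    · simpa using (mkFace_eq_mkFace.1 (key {r} v₀)).1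
end
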